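/- arXiv:2412.07319 — 2 statements merged into one kernel-verified Lean document; each statement's English description precedes it below -/
import Mathlib

section
/- Let k be a prime and let G_k = {A ∈ Sp(4,ℤ) : k divides A₂₁, A₂₃ and A₂₄}. Then the stabilizer {A ∈ G_k : A·e₂ = e₂ or A·e₂ = −e₂} equals the subgroup of Sp(4,ℤ) generated by τ_{e₂}^k, τ_{e₄}, τ_{e₃}, M^k, N^k and −I, where M is the matrix with rows (1,0,0,0), (0,1,0,1), (−1,0,1,0), (0,0,0,1), N is the matrix with rows (1,0,0,0), (0,1,1,0), (0,0,1,0), (1,0,0,1), and I is the identity matrix. -/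
open Matrix

abbrev M4 := Matrix (Fin 4) (Fin 4) ℤ

/-- The standard symplectic form on `ℤ⁴`: `ω(x,y) = x₁y₂ − x₂y₁ + x₃y₄ − x₄y₃`
(written with 0-based indices). -/
def omegaZ (x y : Fin 4 → ℤ) : ℤ :=
  x 0 * y 1 - x 1 * y 0 + x 2 * y 3 - x 3 * y 2

/-- `A ∈ Sp(4,ℤ)`: `A` preserves the symplectic form `ω`. -/
def IsSymp (A : M4) : Prop :=
  ∀ x y : Fin 4 → ℤ, omegaZ (A.mulVec x) (A.mulVec y) = omegaZ x y

/-- The symplectic transvection `τ_v(x) = x − ω(x,v)v`, as a matrix. -/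
def tau (v : Fin 4 → ℤ) : M4 :=
  1 - Matrix.vecMulVec v ![v 1, -v 0, v 3, -v 2]

/-- The matrix `M` of the paper. -/
def Mmat : M4 := !![1, 0, 0, 0; 0, 1, 0, 1; -1, 0, 1, 0; 0, 0, 0, 1]

/-- The matrix `N` of the paper. -/
def Nmat : M4 := !![1, 0, 0, 0; 0, 1, 1, 0; 0, 0, 1, 0; 1, 0, 0, 1]

/-- The stabilizer of `±e₂` in `G_k = {A ∈ Sp(4,ℤ) : k ∣ A₂₁, A₂₃, A₂₄}`, viewed inside
`GL(4,ℤ)`. -/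
def stabE2 (k : ℕ) : Set (GL (Fin 4) ℤ) :=
  {A | IsSymp (A : M4) ∧
    (k : ℤ) ∣ (A : M4) 1 0 ∧ (k : ℤ) ∣ (A : M4) 1 2 ∧ (k : ℤ) ∣ (A : M4) 1 3 ∧
    ((A : M4).mulVec ![0, 1, 0, 0] = ![0, 1, 0, 0] ∨
     (A : M4).mulVec ![0, 1, 0, 0] = -![0, 1, 0, 0])}

/-- The generating set: `τ_{e₂}^k`, `τ_{e₄}`, `τ_{e₃}`, `M^k`, `N^k` and `−I`. -/
def gensE2 (k : ℕ) : Set (GL (Fin 4) ℤ) :=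
  {g | (g : M4) = (tau ![0, 1, 0, 0]) ^ k} ∪
  {g | (g : M4) = tau ![0, 0, 0, 1]} ∪
  {g | (g : M4) = tau ![0, 0, 1, 0]} ∪
  {g | (g : M4) = Mmat ^ k} ∪
  {g | (g : M4) = Nmat ^ k} ∪
  {g | (g : M4) = -1}

/-- The unipotent symplectic matrix fixing `e₂` and acting trivially on `e₂^⊥ / e₂`. -/
def heisMat (p x y : ℤ) : M4 := !![1, 0, 0, 0; p, 1, y, x; -x, 0, 1, 0; y, 0, 0, 1]

theorem heisMat_mul (p x y p' x' y' : ℤ) :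
    heisMat p x y * heisMat p' x' y' = heisMat (p + p' - y * x' + x * y') (x + x') (y + y') := by
  ext i j
  fin_cases i <;> fin_cases j <;> simp [heisMat, Matrix.mul_apply, Fin.sum_univ_four] <;> ring

theorem heisMat_zero : heisMat 0 0 0 = 1 := by
  ext i j
  fin_cases i <;> fin_cases j <;> simp [heisMat]

/-- An additive family of matrices, as a homomorphism from `ℤ` to `GL(4,ℤ)`. -/
def oneParam (f : ℤ → M4) (h0 : f 0 = 1) (hadd : ∀ a b, f (a + b) = f a * f b) :
    Multiplicative ℤ →* GL (Fin 4) ℤ :=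
  MonoidHom.toHomUnits
    { toFun := fun a => f a.toAdd
      map_one' := h0
      map_mul' := fun a b => hadd a.toAdd b.toAdd }

theorem oneParam_coe (f : ℤ → M4) (h0 : f 0 = 1) (hadd : ∀ a b, f (a + b) = f a * f b) (n : ℤ) :
    (oneParam f h0 hadd (Multiplicative.ofAdd n) : M4) = f n := rfl

/-- The family `τ_{e₂}^{-p}`. -/
def centerHom : Multiplicative ℤ →* GL (Fin 4) ℤ :=
  oneParam (fun p => heisMat p 0 0) heisMat_zero (fun a b => by simp [heisMat_mul])

/-- The family `M^x`. -/
def mHom : Multiplicative ℤ →* GL (Fin 4) ℤ :=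
  oneParam (fun x => heisMat 0 x 0) heisMat_zero (fun a b => by simp [heisMat_mul])

/-- The family `N^y`. -/
def nHom : Multiplicative ℤ →* GL (Fin 4) ℤ :=
  oneParam (fun y => heisMat 0 0 y) heisMat_zero (fun a b => by simp [heisMat_mul])

theorem oneParam_pow (f : ℤ → M4) (h0 : f 0 = 1) (hadd : ∀ a b, f (a + b) = f a * f b)
    (n : ℤ) (k : ℕ) : f n ^ k = f (k * n) := by
  rw [← oneParam_coe f h0 hadd, ← oneParam_coe f h0 hadd, ← Units.val_pow_eq_pow_val, ← map_pow,
    ← ofAdd_nsmul, nsmul_eq_mul]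

theorem tau_e2_pow (k : ℕ) : tau ![0, 1, 0, 0] ^ k = heisMat (-k) 0 0 := by
  have h : tau ![0, 1, 0, 0] = heisMat (-1) 0 0 := by
    ext i j
    fin_cases i <;> fin_cases j <;> simp [heisMat, tau]
  rw [h, oneParam_pow (fun p => heisMat p 0 0) heisMat_zero (fun a b => by simp [heisMat_mul])]
  simp

theorem Mmat_pow (k : ℕ) : Mmat ^ k = heisMat 0 k 0 := by
  have h : Mmat = heisMat 0 1 0 := by simp [heisMat, Mmat]
  rw [h, oneParam_pow (fun x => heisMat 0 x 0) heisMat_zero (fun a b => by simp [heisMat_mul])]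
  simp

theorem Nmat_pow (k : ℕ) : Nmat ^ k = heisMat 0 0 k := by
  have h : Nmat = heisMat 0 0 1 := by simp [heisMat, Nmat]
  rw [h, oneParam_pow (fun y => heisMat 0 0 y) heisMat_zero (fun a b => by simp [heisMat_mul])]
  simp

theorem map_ofAdd_mem_of_dvd {G : Type*} [Group G] (F : Multiplicative ℤ →* G) {K : Subgroup G}
    {k m : ℤ} (hF : F (Multiplicative.ofAdd k) ∈ K) (h : k ∣ m) :
    F (Multiplicative.ofAdd m) ∈ K := by
  obtain ⟨n, rfl⟩ := h
  rw [mul_comm, ← smul_eq_mul, ofAdd_zsmul, map_zpow]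
  exact K.zpow_mem hF n

/-- The embedding of a `2 × 2` matrix as the block acting on `e₃, e₄`. -/
def blockMat (s : Matrix (Fin 2) (Fin 2) ℤ) : M4 :=
  !![1, 0, 0, 0; 0, 1, 0, 0; 0, 0, s 0 0, s 0 1; 0, 0, s 1 0, s 1 1]

/-- The embedding of `SL(2,ℤ)` acting on `e₃, e₄`. -/
def blockHom : SpecialLinearGroup (Fin 2) ℤ →* GL (Fin 4) ℤ :=
  MonoidHom.toHomUnits
    { toFun := fun s => blockMat s
      map_one' := by
        ext i j
        fin_cases i <;> fin_cases j <;> simp [blockMat]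
      map_mul' := fun s t => by
        ext i j
        fin_cases i <;> fin_cases j <;>
          simp [blockMat, Matrix.mul_apply, Fin.sum_univ_four] }

theorem blockHom_coe (s : SpecialLinearGroup (Fin 2) ℤ) : (blockHom s : M4) = blockMat s := rfl

theorem tau_e3_eq : tau ![0, 0, 1, 0] = blockMat !![1, 1; 0, 1] := by
  ext i j
  fin_cases i <;> fin_cases j <;> simp [blockMat, tau]

theorem tau_e4_eq : tau ![0, 0, 0, 1] = blockMat !![1, 0; -1, 1] := by
  ext i j
  fin_cases i <;> fin_cases j <;> simp [blockMat, tau]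

theorem blockHom_mem {K : Subgroup (GL (Fin 4) ℤ)}
    (h3 : ∀ g : GL (Fin 4) ℤ, (g : M4) = tau ![0, 0, 1, 0] → g ∈ K)
    (h4 : ∀ g : GL (Fin 4) ℤ, (g : M4) = tau ![0, 0, 0, 1] → g ∈ K)
    (s : SpecialLinearGroup (Fin 2) ℤ) : blockHom s ∈ K := by
  have hT : ModularGroup.T ∈ K.comap blockHom :=
    h3 _ (by rw [tau_e3_eq, blockHom_coe, ModularGroup.coe_T])
  have hL : (ModularGroup.T * ModularGroup.S * ModularGroup.T)⁻¹ ∈ K.comap blockHom :=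
    h4 _ (by
      rw [tau_e4_eq, blockHom_coe]
      congr 1
      decide)
  have hS : ModularGroup.S ∈ K.comap blockHom :=
    (Subgroup.mul_mem_cancel_left _ hT).1 ((Subgroup.mul_mem_cancel_right _ hT).1
      ((K.comap blockHom).inv_mem_iff.1 hL))
  have hle : Subgroup.closure {ModularGroup.S, ModularGroup.T} ≤ K.comap blockHom := by
    rw [Subgroup.closure_le]
    rintro _ (rfl | rfl)
    exacts [hS, hT]
  rw [SpecialLinearGroup.SL2Z_generators] at hle
  exact hle (Subgroup.mem_top s)

theorem isSymp_heisMat (p x y : ℤ) : IsSymp (heisMat p x y) := by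
  intro v w
  simp [omegaZ, heisMat, Matrix.mulVec, dotProduct, Fin.sum_univ_four]
  ring

theorem isSymp_blockMat {s : Matrix (Fin 2) (Fin 2) ℤ} (hs : s.det = 1) :
    IsSymp (blockMat s) := by
  intro v w
  rw [det_fin_two] at hs
  simp [omegaZ, blockMat, Matrix.mulVec, dotProduct, Fin.sum_univ_four]
  linear_combination (v 2 * w 3 - v 3 * w 2) * hs

theorem mulVec_e2_apply (A : M4) (i : Fin 4) : A.mulVec ![0, 1, 0, 0] i = A i 1 := by
  simp [Matrix.mulVec, dotProduct, Fin.sum_univ_four]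

theorem heisMat_mulVec_e2 (p x y : ℤ) :
    (heisMat p x y).mulVec ![0, 1, 0, 0] = ![0, 1, 0, 0] := by
  ext i
  rw [mulVec_e2_apply]
  fin_cases i <;> simp [heisMat]

theorem blockMat_mulVec_e2 (s : Matrix (Fin 2) (Fin 2) ℤ) :
    (blockMat s).mulVec ![0, 1, 0, 0] = ![0, 1, 0, 0] := by
  ext i
  rw [mulVec_e2_apply]
  fin_cases i <;> simp [blockMat]

/-- The stabilizer of `±e₂` in `G_k`, as a subgroup. -/
def stabE2Subgroup (k : ℕ) : Subgroup (GL (Fin 4) ℤ) where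
  carrier := stabE2 k
  one_mem' := by
    refine ⟨fun x y => by simp, ?_, ?_, ?_, Or.inl (by simp)⟩ <;> simp
  mul_mem' := by
    rintro A B ⟨hA, a0, a2, a3, ha⟩ ⟨hB, b0, b2, b3, hb⟩
    refine ⟨fun x y => ?_, ?_, ?_, ?_, ?_⟩
    · rw [Units.val_mul, ← mulVec_mulVec, ← mulVec_mulVec, hA, hB]
    iterate 3
      rw [Units.val_mul, Matrix.mul_apply, Fin.sum_univ_four]
      exact dvd_add (dvd_add (dvd_add (a0.mul_right _) (Dvd.dvd.mul_left ‹_› _))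
        (a2.mul_right _)) (a3.mul_right _)
    · rw [Units.val_mul, ← mulVec_mulVec]
      rcases ha with ha | ha <;> rcases hb with hb | hb <;> rw [hb] <;>
        simp only [mulVec_neg, ha, neg_neg, true_or, or_true]
  inv_mem' := by
    rintro A ⟨hA, a0, a2, a3, ha⟩
    have hmul : (A : M4) * ((A⁻¹ : GL (Fin 4) ℤ) : M4) = 1 := A.mul_inv
    have hinv : ((A⁻¹ : GL (Fin 4) ℤ) : M4) * (A : M4) = 1 := A.inv_mul
    have hu : IsUnit ((A : M4) 1 1) := by
      rw [Int.isUnit_iff, ← mulVec_e2_apply (A : M4) 1]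
      rcases ha with ha | ha <;> rw [ha] <;> simp
    have key : ∀ j : Fin 4, j ≠ 1 → (k : ℤ) ∣ ((A⁻¹ : GL (Fin 4) ℤ) : M4) 1 j := by
      intro j hj
      have h := congrFun (congrFun hmul 1) j
      rw [Matrix.mul_apply, Fin.sum_univ_four, Matrix.one_apply_ne hj.symm] at h
      rw [← hu.dvd_mul_left]
      generalize ((A⁻¹ : GL (Fin 4) ℤ) : M4) = B at h ⊢
      have h' : (A : M4) 1 1 * B 1 j =
          -((A : M4) 1 0 * B 0 j + (A : M4) 1 2 * B 2 j + (A : M4) 1 3 * B 3 j) := by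
        linear_combination h
      rw [h', dvd_neg]
      exact dvd_add (dvd_add (a0.mul_right _) (a2.mul_right _)) (a3.mul_right _)
    refine ⟨fun x y => ?_, key 0 (by decide), key 2 (by decide), key 3 (by decide), ?_⟩
    · rw [← hA, mulVec_mulVec, mulVec_mulVec, hmul, one_mulVec, one_mulVec]
    · refine ha.imp (fun h => ?_) (fun h => ?_)
      · conv_lhs => rw [← h]
        rw [mulVec_mulVec, hinv, one_mulVec]
      · have h' := congrArg (((A⁻¹ : GL (Fin 4) ℤ) : M4).mulVec) h
        rw [mulVec_mulVec, hinv, one_mulVec, mulVec_neg] at h'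
        exact neg_eq_iff_eq_neg.1 h'.symm

theorem gensE2_subset_stabE2 (k : ℕ) : gensE2 k ⊆ stabE2 k := by
  have heis : ∀ (g : GL (Fin 4) ℤ) (p x y : ℤ), (k : ℤ) ∣ p → (k : ℤ) ∣ x → (k : ℤ) ∣ y →
      (g : M4) = heisMat p x y → g ∈ stabE2 k := by
    intro g p x y hp hx hy h
    refine ⟨?_, ?_, ?_, ?_, Or.inl ?_⟩ <;> rw [h]
    exacts [isSymp_heisMat _ _ _, hp, hy, hx, heisMat_mulVec_e2 _ _ _]
  have block : ∀ (g : GL (Fin 4) ℤ) (s : Matrix (Fin 2) (Fin 2) ℤ), s.det = 1 →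
      (g : M4) = blockMat s → g ∈ stabE2 k := by
    intro g s hs h
    refine ⟨?_, ?_, ?_, ?_, Or.inl ?_⟩ <;> rw [h]
    exacts [isSymp_blockMat hs, dvd_zero _, dvd_zero _, dvd_zero _, blockMat_mulVec_e2 _]
  rintro g (((((h | h) | h) | h) | h) | h)
  · exact heis g _ _ _ (by simp) (by simp) (by simp) (h.trans (tau_e2_pow k))
  · exact block g _ (by simp) (h.trans tau_e4_eq)
  · exact block g _ (by simp) (h.trans tau_e3_eq)
  · exact heis g _ _ _ (by simp) (by simp) (by simp) (h.trans (Mmat_pow k))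
  · exact heis g _ _ _ (by simp) (by simp) (by simp) (h.trans (Nmat_pow k))
  · have h : (g : M4) = -1 := h
    refine ⟨fun x y => ?_, ?_, ?_, ?_, Or.inr ?_⟩ <;> rw [h]
    · simp [omegaZ, neg_mulVec]
    iterate 3 simp
    · rw [neg_mulVec, one_mulVec]

theorem omegaZ_col {A : M4} (hA : IsSymp A) (i j : Fin 4) :
    omegaZ (fun l => A l i) (fun l => A l j) = omegaZ (Pi.single i 1) (Pi.single j 1) := by
  have h := hA (Pi.single i 1) (Pi.single j 1)
  rwa [mulVec_single_one, mulVec_single_one] at h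

/-- A symplectic matrix fixing `e₂` is a unipotent matrix times a block in `SL(2,ℤ)`. -/
theorem exists_eq_heisMat_mul_blockMat {A : M4} (hA : IsSymp A)
    (h : A.mulVec ![0, 1, 0, 0] = ![0, 1, 0, 0]) :
    ∃ s : SpecialLinearGroup (Fin 2) ℤ,
      A = heisMat (A 1 0) (-A 2 0) (A 3 0) * blockMat s ∧
      -A 2 0 = A 1 3 * A 2 2 - A 1 2 * A 2 3 ∧ A 3 0 = A 1 2 * A 3 3 - A 1 3 * A 3 2 := by
  have c : ∀ i, A i 1 = ![0, 1, 0, 0] i := fun i => by rw [← mulVec_e2_apply A i, h]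
  have c0 : A 0 1 = 0 := c 0
  have c1 : A 1 1 = 1 := c 1
  have c2 : A 2 1 = 0 := c 2
  have c3 : A 3 1 = 0 := c 3
  have r0 := omegaZ_col hA 0 1
  have r2 := omegaZ_col hA 2 1
  have r3 := omegaZ_col hA 3 1
  have q2 := omegaZ_col hA 0 2
  have q3 := omegaZ_col hA 0 3
  have d := omegaZ_col hA 2 3
  simp [omegaZ, c0, c1, c2, c3] at r0 r2 r3
  simp [omegaZ, r0, r2, r3] at q2 q3 d
  refine ⟨⟨!![A 2 2, A 2 3; A 3 2, A 3 3], by rw [det_fin_two_of]; linear_combination d⟩,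
    ?_, ?_, ?_⟩
  · ext i j
    fin_cases i <;> fin_cases j <;>
      simp [heisMat, blockMat, Matrix.mul_apply, Fin.sum_univ_four, c0, c1, c2, c3, r0, r2, r3]
    · linear_combination q2
    · linear_combination q3
  · linear_combination (A 2 0) * d - A 2 2 * q3 + A 2 3 * q2
  · linear_combination (-A 3 0) * d - A 3 3 * q2 + A 3 2 * q3

theorem mem_closure_of_fix_e2 {k : ℕ} {A : GL (Fin 4) ℤ} (hA : IsSymp (A : M4))
    (h0 : (k : ℤ) ∣ (A : M4) 1 0) (h2 : (k : ℤ) ∣ (A : M4) 1 2) (h3 : (k : ℤ) ∣ (A : M4) 1 3)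
    (h : (A : M4).mulVec ![0, 1, 0, 0] = ![0, 1, 0, 0]) :
    A ∈ Subgroup.closure (gensE2 k) := by
  obtain ⟨s, hs, hx, hy⟩ := exists_eq_heisMat_mul_blockMat hA h
  have dx : (k : ℤ) ∣ -(A : M4) 2 0 := hx ▸ dvd_sub (h3.mul_right _) (h2.mul_right _)
  have dy : (k : ℤ) ∣ (A : M4) 3 0 := hy ▸ dvd_sub (h2.mul_right _) (h3.mul_right _)
  generalize -(A : M4) 2 0 = x at hs dx
  generalize (A : M4) 3 0 = y at hs dy
  generalize (A : M4) 1 0 = p at hs h0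
  have hfac : A = centerHom (Multiplicative.ofAdd (p - x * y)) * mHom (Multiplicative.ofAdd x) *
      nHom (Multiplicative.ofAdd y) * blockHom s := by
    apply Units.ext
    rw [hs, Units.val_mul, Units.val_mul, Units.val_mul, blockHom_coe, centerHom, mHom, nHom,
      oneParam_coe, oneParam_coe, oneParam_coe, heisMat_mul, heisMat_mul]
    simp
  rw [hfac]
  refine mul_mem (mul_mem (mul_mem ?_ ?_) ?_) ?_
  · refine map_ofAdd_mem_of_dvd _ (k := -k) (Subgroup.subset_closure ?_)
      (neg_dvd.2 (dvd_sub h0 (dx.mul_right _)))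
    exact Or.inl (Or.inl (Or.inl (Or.inl (Or.inl (tau_e2_pow k).symm))))
  · refine map_ofAdd_mem_of_dvd _ (Subgroup.subset_closure ?_) dx
    exact Or.inl (Or.inl (Or.inr (Mmat_pow k).symm))
  · refine map_ofAdd_mem_of_dvd _ (Subgroup.subset_closure ?_) dy
    exact Or.inl (Or.inr (Nmat_pow k).symm)
  · refine blockHom_mem (fun g hg => Subgroup.subset_closure ?_)
      (fun g hg => Subgroup.subset_closure ?_) s
    · exact Or.inl (Or.inl (Or.inl (Or.inr hg)))
    · exact Or.inl (Or.inl (Or.inl (Or.inl (Or.inr hg))))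

/-- For `k` prime, the stabilizer of `±e₂` in `G_k` is generated by `τ_{e₂}^k`, `τ_{e₄}`,
`τ_{e₃}`, `M^k`, `N^k` and `−I`. -/
theorem stabilizer_e2_eq_closure (k : ℕ) (hk : Nat.Prime k) :
    stabE2 k = (Subgroup.closure (gensE2 k) : Set (GL (Fin 4) ℤ)) := by
  apply Set.Subset.antisymm
  · rintro A ⟨hA, h0, h2, h3, h | h⟩
    · exact mem_closure_of_fix_e2 hA h0 h2 h3 h
    · have hneg : (-1 : GL (Fin 4) ℤ) ∈ Subgroup.closure (gensE2 k) :=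
        Subgroup.subset_closure (Or.inr (by simp))
      have hmem : -A ∈ Subgroup.closure (gensE2 k) := by
        apply mem_closure_of_fix_e2
        · intro x y
          rw [Units.val_neg, neg_mulVec, neg_mulVec, ← hA x y]
          simp [omegaZ]
        iterate 3 simpa
        · rw [Units.val_neg, neg_mulVec, h, neg_neg]
      simpa using mul_mem hneg hmem
  · exact (Subgroup.closure_le (stabE2Subgroup k)).2 (gensE2_subset_stabE2 k)
end

section
/- Let H_ℤ = {A ∈ Sp(4,ℤ) : A₁₃, A₁₄, A₂₃, A₂₄, A₃₁, A₃₂, A₄₁, A₄₂ are all even}. Then the stabilizer {A ∈ H_ℤ : A·e₁ = e₁ or A·e₁ = −e₁} equals the subgroup of Sp(4,ℤ) generated by (M′)², (N′)², τ_{e₁}, τ_{e₄}, τ_{e₃} and −I, where M′ is the matrix with rows (1,0,0,1), (0,1,0,0), (0,1,1,0), (0,0,0,1), N′ is the matrix with rows (1,0,1,0), (0,1,0,0), (0,0,1,0), (0,−1,0,1), and I is the identity matrix. -/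
open Matrix

/-- `A ∈ H_ℤ = {A ∈ Sp(4,ℤ) : A₁₃, A₁₄, A₂₃, A₂₄, A₃₁, A₃₂, A₄₁, A₄₂ even}`
(1-based entries). -/
def InHZ (A : M4) : Prop :=
  IsSymp A ∧ (2 : ℤ) ∣ A 0 2 ∧ (2 : ℤ) ∣ A 0 3 ∧ (2 : ℤ) ∣ A 1 2 ∧ (2 : ℤ) ∣ A 1 3 ∧
    (2 : ℤ) ∣ A 2 0 ∧ (2 : ℤ) ∣ A 2 1 ∧ (2 : ℤ) ∣ A 3 0 ∧ (2 : ℤ) ∣ A 3 1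

/-- The matrix `M′` of the paper. -/
def Mpmat : M4 := !![1, 0, 0, 1; 0, 1, 0, 0; 0, 1, 1, 0; 0, 0, 0, 1]

/-- The matrix `N′` of the paper. -/
def Npmat : M4 := !![1, 0, 1, 0; 0, 1, 0, 0; 0, 0, 1, 0; 0, -1, 0, 1]

/-- The stabilizer of `±e₁` in `H_ℤ`, viewed inside `GL(4,ℤ)`. -/
def stabE1H : Set (GL (Fin 4) ℤ) :=
  {A | InHZ (A : M4) ∧
    ((A : M4).mulVec ![1, 0, 0, 0] = ![1, 0, 0, 0] ∨
     (A : M4).mulVec ![1, 0, 0, 0] = -![1, 0, 0, 0])}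

/-- The generating set `(M′)², (N′)², τ_{e₁}, τ_{e₄}, τ_{e₃}, −I`. -/
def gensE1H : Set (GL (Fin 4) ℤ) :=
  {g | (g : M4) = Mpmat ^ 2} ∪
  {g | (g : M4) = Npmat ^ 2} ∪
  {g | (g : M4) = tau ![1, 0, 0, 0]} ∪
  {g | (g : M4) = tau ![0, 0, 0, 1]} ∪
  {g | (g : M4) = tau ![0, 0, 1, 0]} ∪
  {g | (g : M4) = -1}

/-- The stabilizer of `±e₁` in `H_ℤ`, as a subgroup of `GL(4,ℤ)`. -/
def stabE1HSubgroup : Subgroup (GL (Fin 4) ℤ) where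
  carrier := stabE1H
  one_mem' := by
    refine ⟨⟨fun x y => by simp, ?_⟩, by simp⟩
    simp
  mul_mem' := by
    rintro A B ⟨⟨hA, a1, a2, a3, a4, a5, a6, a7, a8⟩, hA1⟩
      ⟨⟨hB, b1, b2, b3, b4, b5, b6, b7, b8⟩, hB1⟩
    refine ⟨⟨fun x y => ?_, ?_⟩, ?_⟩
    · rw [Units.val_mul, ← Matrix.mulVec_mulVec, ← Matrix.mulVec_mulVec, hA, hB]
    · simp only [Units.val_mul, Matrix.mul_apply, Fin.sum_univ_four]
      refine ⟨?_, ?_, ?_, ?_, ?_, ?_, ?_, ?_⟩ <;>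
        refine dvd_add (dvd_add (dvd_add ?_ ?_) ?_) ?_ <;>
        first
          | exact Dvd.dvd.mul_left (by assumption) _
          | exact Dvd.dvd.mul_right (by assumption) _
    · rw [Units.val_mul, ← Matrix.mulVec_mulVec]
      rcases hA1 with h | h <;> rcases hB1 with h' | h' <;> rw [h'] <;>
        simp only [Matrix.mulVec_neg, h, neg_neg, true_or, or_true]
  inv_mem' := by
    rintro A ⟨⟨hA, a1, a2, a3, a4, a5, a6, a7, a8⟩, hA1⟩
    have mul_inv_vec (x : Fin 4 → ℤ) :
        (A : M4).mulVec (((A⁻¹ : GL (Fin 4) ℤ) : M4).mulVec x) = x := by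
      rw [Matrix.mulVec_mulVec, ← Units.val_mul, mul_inv_cancel, Units.val_one, Matrix.one_mulVec]
    have inv_mul_vec (x : Fin 4 → ℤ) :
        ((A⁻¹ : GL (Fin 4) ℤ) : M4).mulVec ((A : M4).mulVec x) = x := by
      rw [Matrix.mulVec_mulVec, ← Units.val_mul, inv_mul_cancel, Units.val_one, Matrix.one_mulVec]
    have adjoint (x y : Fin 4 → ℤ) :
        omegaZ (((A⁻¹ : GL (Fin 4) ℤ) : M4).mulVec x) y = omegaZ x ((A : M4).mulVec y) := by
      rw [← hA, mul_inv_vec]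
    have entries (i j : Fin 4) := adjoint (Pi.single i 1) (Pi.single j 1)
    simp only [Matrix.mulVec_single_one, omegaZ, Matrix.col_apply] at entries
    refine ⟨⟨fun x y => ?_, ?_⟩, ?_⟩
    · rw [← hA, mul_inv_vec, mul_inv_vec]
    · have e20 := entries 2 0
      have e21 := entries 2 1
      have e30 := entries 3 0
      have e31 := entries 3 1
      have e02 := entries 0 2
      have e03 := entries 0 3
      have e12 := entries 1 2
      have e13 := entries 1 3
      simp [-Matrix.coe_units_inv] at e20 e21 e30 e31 e02 e03 e12 e13
      omega
    · have h0 := inv_mul_vec ![1, 0, 0, 0]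
      rcases hA1 with h | h
      · rw [h] at h0
        exact Or.inl h0
      · rw [h, Matrix.mulVec_neg] at h0
        exact Or.inr (neg_eq_iff_eq_neg.mp h0)

/-- The one-parameter subgroup of the Heisenberg group (the unipotent radical of the stabilizer of
`e₁`) in the direction `(x, y, t)`. -/
def heisenberg (x y t : ℤ) : Multiplicative ℤ →* M4 where
  toFun k := !![1, k.toAdd * t, -(k.toAdd * y), k.toAdd * x; 0, 1, 0, 0;
    0, k.toAdd * x, 1, 0; 0, k.toAdd * y, 0, 1]
  map_one' := by
    ext i j
    fin_cases i <;> fin_cases j <;> simp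
  map_mul' k l := by
    ext i j
    fin_cases i <;> fin_cases j <;> simp [Matrix.mul_apply, Fin.sum_univ_four] <;> ring

/-- The embedding of `SL(2,ℤ)` into `Sp(4,ℤ)` acting on the span of `e₃` and `e₄`. -/
def lowerBlock : SpecialLinearGroup (Fin 2) ℤ →* M4 where
  toFun g := !![1, 0, 0, 0; 0, 1, 0, 0; 0, 0, g 0 0, g 0 1; 0, 0, g 1 0, g 1 1]
  map_one' := by
    ext i j
    fin_cases i <;> fin_cases j <;> simp
  map_mul' g h := by
    ext i j
    fin_cases i <;> fin_cases j <;> simp [Matrix.mul_apply, Fin.sum_univ_four, Fin.sum_univ_two]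

lemma heisenberg_mem {x y t : ℤ} {K : Subgroup (GL (Fin 4) ℤ)}
    (h : (heisenberg x y t).toHomUnits (Multiplicative.ofAdd 1) ∈ K) (k : ℤ) :
    (heisenberg x y t).toHomUnits (Multiplicative.ofAdd k) ∈ K := by
  have hk : Multiplicative.ofAdd k = Multiplicative.ofAdd (1 : ℤ) ^ k := by
    rw [← ofAdd_zsmul, smul_eq_mul, mul_one]
  rw [hk, map_zpow]
  exact K.zpow_mem h k

lemma Mpmat_sq : Mpmat ^ 2 = heisenberg 2 0 0 (Multiplicative.ofAdd 1) := by
  simp only [Mpmat, sq, heisenberg, MonoidHom.coe_mk, OneHom.coe_mk, toAdd_ofAdd]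
  decide

lemma Npmat_sq : Npmat ^ 2 = heisenberg 0 (-2) 0 (Multiplicative.ofAdd 1) := by
  simp only [Npmat, sq, heisenberg, MonoidHom.coe_mk, OneHom.coe_mk, toAdd_ofAdd]
  decide

lemma tau_e1 : tau ![1, 0, 0, 0] = heisenberg 0 0 1 (Multiplicative.ofAdd 1) := by
  simp only [tau, heisenberg, MonoidHom.coe_mk, OneHom.coe_mk, toAdd_ofAdd]
  decide

lemma tau_e3 : tau ![0, 0, 1, 0] = lowerBlock ModularGroup.T := by
  simp only [tau, lowerBlock, MonoidHom.coe_mk, OneHom.coe_mk]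
  decide

lemma tau_e4 : tau ![0, 0, 0, 1] =
    lowerBlock (ModularGroup.T * ModularGroup.S * ModularGroup.T)⁻¹ := by
  simp only [tau, lowerBlock, MonoidHom.coe_mk, OneHom.coe_mk]
  decide

lemma lowerBlock_mem_closure (g : SpecialLinearGroup (Fin 2) ℤ) :
    lowerBlock.toHomUnits g ∈ Subgroup.closure gensE1H := by
  suffices h : (Subgroup.closure gensE1H).comap lowerBlock.toHomUnits = ⊤ from
    Subgroup.mem_comap.mp (h ▸ Subgroup.mem_top g)
  have hT : ModularGroup.T ∈ (Subgroup.closure gensE1H).comap lowerBlock.toHomUnits :=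
    Subgroup.subset_closure (Or.inl (Or.inr tau_e3.symm))
  have hL : (ModularGroup.T * ModularGroup.S * ModularGroup.T)⁻¹ ∈
      (Subgroup.closure gensE1H).comap lowerBlock.toHomUnits :=
    Subgroup.subset_closure (Or.inl (Or.inl (Or.inr tau_e4.symm)))
  rw [Subgroup.inv_mem_iff, Subgroup.mul_mem_cancel_right _ hT,
    Subgroup.mul_mem_cancel_left _ hT] at hL
  rw [eq_top_iff, ← SpecialLinearGroup.SL2Z_generators, Subgroup.closure_le]
  rintro _ (rfl | rfl)
  exacts [hL, hT]

lemma mem_closure_of_fixes_e1 {A : GL (Fin 4) ℤ} (hA : InHZ (A : M4))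
    (h1 : (A : M4).mulVec ![1, 0, 0, 0] = ![1, 0, 0, 0]) : A ∈ Subgroup.closure gensE1H := by
  obtain ⟨hS, -, -, -, -, -, ⟨k, hk⟩, -, ⟨l, hl⟩⟩ := hA
  have col (i : Fin 4) := congrFun h1 i
  have c0 := col 0
  have c1 := col 1
  have c2 := col 2
  have c3 := col 3
  simp [Matrix.mulVec, dotProduct, Fin.sum_univ_four] at c0 c1 c2 c3
  have entries (i j : Fin 4) := hS (Pi.single i 1) (Pi.single j 1)
  simp only [Matrix.mulVec_single_one, omegaZ, Matrix.col_apply] at entries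
  have e01 := entries 0 1
  have e02 := entries 0 2
  have e03 := entries 0 3
  have e12 := entries 1 2
  have e13 := entries 1 3
  have e23 := entries 2 3
  simp [c0, c1, c2, c3] at e01 e02 e03
  simp [e01, e02, e03, hk, hl] at e12 e13 e23
  let g : SpecialLinearGroup (Fin 2) ℤ :=
    ⟨!![(A : M4) 2 2, (A : M4) 2 3; (A : M4) 3 2, (A : M4) 3 3], by
      rw [Matrix.det_fin_two_of]; linarith⟩
  have hM := heisenberg_mem (K := Subgroup.closure gensE1H)
    (Subgroup.subset_closure
      (Or.inl (Or.inl (Or.inl (Or.inl (Or.inl Mpmat_sq.symm)))))) k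
  have hN := heisenberg_mem (K := Subgroup.closure gensE1H)
    (Subgroup.subset_closure
      (Or.inl (Or.inl (Or.inl (Or.inl (Or.inr Npmat_sq.symm)))))) (-l)
  have ht := heisenberg_mem (K := Subgroup.closure gensE1H)
    (Subgroup.subset_closure
      (Or.inl (Or.inl (Or.inl (Or.inr tau_e1.symm))))) ((A : M4) 0 1 - 4 * k * l)
  have key := mul_mem (mul_mem (mul_mem hM hN) ht) (lowerBlock_mem_closure g)
  convert key using 1
  apply Units.ext
  simp only [Units.val_mul, MonoidHom.coe_toHomUnits, heisenberg, lowerBlock, MonoidHom.coe_mk,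
    OneHom.coe_mk, toAdd_ofAdd]
  ext i j
  fin_cases i <;> fin_cases j <;>
    simp [g, Matrix.mul_apply, Fin.sum_univ_four, *] <;> linarith

lemma gensE1H_subset_stabE1H : gensE1H ⊆ stabE1H := by
  rintro A (((((h | h) | h) | h) | h) | h) <;> simp only [Set.mem_ofPred_eq] at h <;>
    simp only [stabE1H, InHZ, IsSymp, Set.mem_ofPred_eq, h] <;>
    refine ⟨⟨fun x y => ?_, by decide⟩, by decide⟩ <;>
    simp [omegaZ, tau, Mpmat, Npmat, sq, Matrix.mulVec, dotProduct, Fin.sum_univ_four,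
      Matrix.one_apply, Matrix.mul_apply] <;>
    ring

/-- The stabilizer of `±e₁` in `H_ℤ` is generated by `(M′)²`, `(N′)²`, `τ_{e₁}`, `τ_{e₄}`,
`τ_{e₃}` and `−I`. -/
theorem stabilizer_e1_klein_eq_closure :
    stabE1H = (Subgroup.closure gensE1H : Set (GL (Fin 4) ℤ)) := by
  refine Set.Subset.antisymm ?_ ((Subgroup.closure_le stabE1HSubgroup).mpr gensE1H_subset_stabE1H)
  rintro A ⟨hA, h | h⟩
  · exact mem_closure_of_fixes_e1 hA h
  · have hneg : (-1 : GL (Fin 4) ℤ) ∈ Subgroup.closure gensE1H :=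
      Subgroup.subset_closure (Or.inr (by simp))
    have hmem : -A ∈ stabE1HSubgroup := by
      rw [← neg_one_mul]
      exact mul_mem (gensE1H_subset_stabE1H (Or.inr (by simp))) ⟨hA, Or.inr h⟩
    have hfix : ((-A : GL (Fin 4) ℤ) : M4).mulVec ![1, 0, 0, 0] = ![1, 0, 0, 0] := by
      rw [Units.val_neg, Matrix.neg_mulVec, h, neg_neg]
    have := mul_mem hneg (mem_closure_of_fixes_e1 hmem.1 hfix)
    rwa [neg_one_mul, neg_neg] at this
end
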